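/- Let n divide q - 1 and let f ∈ F_q[x] be nonconstant. Suppose there exist x_0 ∈ F_q and y_0 ∈ F_q* with y_0^n = f(x_0). Then every irreducible factor of y^n - f(x) in F_q[x,y] remains irreducible over the algebraic closure of F_q. -/

import Mathlib

open Polynomial MvPolynomial

/-- A nonunit divisor of `y ^ n - f(x)` has a zero above every `x`. -/
theorem exists_eval_eq_zero_of_dvd_X_pow_sub {K : Type*} [Field K] [IsAlgClosed K] {n : ℕ}
    (hn : n ≠ 0) (f : Polynomial K) (x : K) {P : MvPolynomial (Fin 2) K} (hP : ¬ IsUnit P)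
    (hdvd : P ∣ (MvPolynomial.X 1 ^ n -
      Polynomial.aeval (MvPolynomial.X 0) f : MvPolynomial (Fin 2) K)) :
    ∃ y : K, MvPolynomial.eval ![x, y] P = 0 := by
  let φ : MvPolynomial (Fin 2) K →ₐ[K] Polynomial (Polynomial K) :=
    MvPolynomial.aeval ![Polynomial.C Polynomial.X, Polynomial.X]
  let ψ : Polynomial (Polynomial K) →+* MvPolynomial (Fin 2) K :=
    Polynomial.eval₂RingHom
      (Polynomial.aeval (MvPolynomial.X 0 : MvPolynomial (Fin 2) K)).toRingHom
      (MvPolynomial.X 1)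
  have hψφ : ψ.comp φ.toRingHom = RingHom.id _ := by
    apply MvPolynomial.ringHom_ext
    · intro r
      simp [φ, ψ, Polynomial.algebraMap_apply, MvPolynomial.algebraMap_eq]
    · intro i
      fin_cases i <;> simp [φ, ψ]
  have hφf : φ (Polynomial.aeval (MvPolynomial.X 0) f) = Polynomial.C f := by
    rw [← Polynomial.aeval_algHom_apply]
    have h0 : φ (MvPolynomial.X 0) = Polynomial.C Polynomial.X := by simp [φ]
    rw [h0]
    have := Polynomial.aeval_algHom_apply
      (Algebra.algHom K (Polynomial K) (Polynomial (Polynomial K))) Polynomial.X f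
    simpa [Algebra.algHom, Polynomial.algebraMap_eq] using this
  obtain ⟨R, hR⟩ := hdvd
  have hmul : φ P * φ R = Polynomial.X ^ n - Polynomial.C f := by
    rw [← map_mul, ← hR, map_sub, map_pow, hφf]
    simp [φ]
  have hlead : IsUnit (φ P).leadingCoeff := by
    have h := congrArg Polynomial.leadingCoeff hmul
    rw [Polynomial.leadingCoeff_mul, (Polynomial.monic_X_pow_sub_C f hn).leadingCoeff] at h
    exact IsUnit.of_mul_eq_one _ h
  have hdeg : (φ P).natDegree ≠ 0 := by
    intro h0
    apply hP
    have hu : IsUnit (φ P) := by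
      rw [Polynomial.eq_C_of_natDegree_eq_zero h0]
      rw [Polynomial.leadingCoeff, h0] at hlead
      exact hlead.map Polynomial.C
    have := hu.map ψ
    rwa [show ψ (φ P) = P from RingHom.congr_fun hψφ P] at this
  have hdeg' : ((φ P).map (Polynomial.evalRingHom x)).degree ≠ 0 := by
    intro h
    apply hdeg
    rw [← Polynomial.natDegree_map_eq_of_isUnit_leadingCoeff (Polynomial.evalRingHom x) hlead]
    exact Polynomial.natDegree_eq_of_degree_eq_some h
  obtain ⟨y, hy⟩ := IsAlgClosed.exists_root _ hdeg'
  refine ⟨y, ?_⟩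
  have hcomp : ((Polynomial.evalRingHom y).comp
      (Polynomial.mapRingHom (Polynomial.evalRingHom x))).comp φ.toRingHom =
      MvPolynomial.eval ![x, y] := by
    apply MvPolynomial.ringHom_ext
    · intro r
      simp [φ, Polynomial.algebraMap_apply]
    · intro i
      fin_cases i <;> simp [φ]
  rw [← hcomp]
  exact hy

/-- An element of a field extending a finite field that is fixed by the Frobenius
lies in the finite field. -/
theorem FiniteField.mem_range_algebraMap_of_pow_card_eq {F K : Type*} [Field F] [Fintype F]
    [Field K] [Algebra F K] {c : K} (hc : c ^ Fintype.card F = c) :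
    c ∈ Set.range (algebraMap F K) := by
  have hprod : (Polynomial.X ^ Fintype.card F - Polynomial.X : Polynomial F) =
      (Finset.univ.val.map fun a : F => Polynomial.X - Polynomial.C a).prod := by
    have hmonic : (Polynomial.X ^ Fintype.card F - Polynomial.X : Polynomial F).Monic :=
      Polynomial.monic_X_pow_sub (by
        rw [Polynomial.degree_X]; exact_mod_cast Fintype.one_lt_card)
    have h := Polynomial.prod_multiset_X_sub_C_of_monic_of_roots_card_eq hmonic (by
      rw [FiniteField.roots_X_pow_card_sub_X,
        FiniteField.X_pow_card_sub_X_natDegree_eq F Fintype.one_lt_card]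
      rfl)
    rw [FiniteField.roots_X_pow_card_sub_X] at h
    exact h.symm
  have h := congrArg (Polynomial.aeval c) hprod
  change _ = Polynomial.aeval c (∏ a : F, (Polynomial.X - Polynomial.C a)) at h
  simp only [map_sub, map_pow, Polynomial.aeval_X, hc, sub_self, map_prod,
    Polynomial.aeval_C] at h
  obtain ⟨a, -, ha⟩ := Finset.prod_eq_zero_iff.1 h.symm
  exact ⟨a, (sub_eq_zero.1 ha).symm⟩

/-- A multivariate polynomial fixed by the Frobenius on coefficients descends to the finite
field. -/
theorem MvPolynomial.mem_range_map_of_map_frobenius_eq {σ F K : Type*} [Field F] [Fintype F]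
    [Field K] [Algebra F K] [Algebra.IsAlgebraic F K] {Q : MvPolynomial σ K}
    (hQ : Q.map (FiniteField.frobeniusAlgEquivOfAlgebraic F K : K →+* K) = Q) :
    Q ∈ Set.range (MvPolynomial.map (σ := σ) (algebraMap F K)) := by
  rw [MvPolynomial.mem_range_map_iff_coeffs_subset]
  intro c hc
  obtain ⟨m, -, rfl⟩ := MvPolynomial.mem_coeffs_iff.1 hc
  apply FiniteField.mem_range_algebraMap_of_pow_card_eq
  have h := congrArg (MvPolynomial.coeff m) hQ
  rwa [MvPolynomial.coeff_map] at h

/-- If `G` vanishes at `v` but one of its partial derivatives does not, then `G` is not divisible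
by a product of two polynomials vanishing at `v`. -/
theorem MvPolynomial.not_mul_dvd_of_eval_pderiv_ne_zero {σ K : Type*} [CommRing K]
    {v : σ → K} {i : σ} {A B G : MvPolynomial σ K} (hA : eval v A = 0) (hB : eval v B = 0)
    (hG : eval v (pderiv i G) ≠ 0) : ¬ A * B ∣ G := by
  rintro ⟨R, rfl⟩
  apply hG
  simp [Derivation.leibniz, hA, hB]

theorem exists_irreducible_dvd_of_map_eq_zero {R S : Type*} [CommRing R] [IsDomain R]
    [UniqueFactorizationMonoid R] [CommRing S] [IsDomain S] (g : R →+* S) {a : R} (ha : a ≠ 0)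
    (h : g a = 0) : ∃ p, Irreducible p ∧ p ∣ a ∧ g p = 0 := by
  obtain ⟨s, hs, hsa⟩ := UniqueFactorizationMonoid.exists_prime_factors a ha
  have h0 : g s.prod = 0 := zero_dvd_iff.1 (h ▸ map_dvd g hsa.symm.dvd)
  rw [map_multiset_prod, Multiset.prod_eq_zero_iff, Multiset.mem_map] at h0
  obtain ⟨p, hp, hp0⟩ := h0
  exact ⟨p, (hs p hp).irreducible, (Multiset.dvd_prod hp).trans hsa.dvd, hp0⟩

/-- If an irreducible `P` over a finite field has, over an algebraic extension, an irreducible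
factor vanishing at a rational point at which a multiple `G` of `P` is smooth, then `P` remains
irreducible over the extension. -/
theorem MvPolynomial.irreducible_map_of_smooth_rational_point {σ F K : Type*} [Field F] [Fintype F]
    [Field K] [Algebra F K] [Algebra.IsAlgebraic F K] {P : MvPolynomial σ F}
    (hP : Irreducible P) {v : σ → K} (hv : ∀ i, v i ^ Fintype.card F = v i)
    (hPv : eval v (P.map (algebraMap F K)) = 0) {G : MvPolynomial σ K}
    (hPG : P.map (algebraMap F K) ∣ G) {i : σ} (hG : eval v (pderiv i G) ≠ 0) :
    Irreducible (P.map (algebraMap F K)) := by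
  have hinj : Function.Injective (MvPolynomial.map (σ := σ) (algebraMap F K)) :=
    MvPolynomial.map_injective _ (algebraMap F K).injective
  have hP0 : P.map (algebraMap F K) ≠ 0 := (map_ne_zero_iff _ hinj).2 hP.ne_zero
  obtain ⟨Q, hQ, hQP, hQv⟩ := exists_irreducible_dvd_of_map_eq_zero (eval v) hP0 hPv
  obtain ⟨m, hm⟩ := MvPolynomial.ne_zero_iff.1 hQ.ne_zero
  wlog hm1 : coeff m Q = 1 generalizing Q
  · have hu : IsUnit (C (coeff m Q)⁻¹ : MvPolynomial σ K) :=
      (isUnit_iff_ne_zero.2 (inv_ne_zero hm)).map C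
    have hass : Associated Q (C (coeff m Q)⁻¹ * Q) :=
      (associated_isUnit_mul_right_iff hu).2 (.refl _)
    refine this (C (coeff m Q)⁻¹ * Q) (hass.irreducible hQ) (hass.dvd_iff_dvd_left.1 hQP) ?_ ?_ ?_
    · simp [hQv]
    · simp [hm]
    · simp [hm]
  let e := FiniteField.frobeniusAlgEquivOfAlgebraic F K
  let E : MvPolynomial σ K ≃+* MvPolynomial σ K := MvPolynomial.mapEquiv σ e.toRingEquiv
  have hE : ∀ A, E A = A.map (e : K →+* K) := fun A => rfl
  have hEP : ∀ A : MvPolynomial σ F, E (A.map (algebraMap F K)) = A.map (algebraMap F K) := by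
    intro A
    rw [hE, MvPolynomial.map_map]
    have hcomp : (e : K →+* K).comp (algebraMap F K) = algebraMap F K :=
      RingHom.ext fun x => e.commutes x
    rw [hcomp]
  have hEQP : E Q ∣ P.map (algebraMap F K) := hEP P ▸ map_dvd E hQP
  have hEQ : Irreducible (E Q) := (MulEquiv.irreducible_iff E).2 hQ
  have hEQv : eval v (E Q) = 0 := by
    have h := MvPolynomial.map_eval (e : K →+* K) v Q
    have hev : (e : K →+* K) ∘ v = v := _root_.funext hv
    rw [hQv, map_zero, hev] at h
    exact h.symm
  have hass : Associated Q (E Q) := by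
    obtain ⟨R, hR⟩ := hEQP
    rw [hR] at hQP
    rcases hQ.prime.dvd_or_dvd hQP with h | h
    · exact hQ.associated_of_dvd hEQ h
    · refine (not_mul_dvd_of_eval_pderiv_ne_zero hEQv hQv hG ?_).elim
      exact (mul_dvd_mul_left _ h).trans (hR ▸ hPG)
  have hfix : E Q = Q := by
    obtain ⟨u, hu⟩ := hass
    obtain ⟨c, -, hc⟩ := MvPolynomial.isUnit_iff_eq_C_of_isReduced.1 u.isUnit
    rw [hc, mul_comm] at hu
    have h := congrArg (coeff m) hu
    rw [MvPolynomial.coeff_C_mul, hm1, hE, MvPolynomial.coeff_map, hm1, map_one, mul_one] at h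
    rw [← hu, h, C_1, one_mul]
  obtain ⟨T, hT⟩ := hQP
  have hTfix : E T = T := by
    have h := hEP P
    rw [hT, map_mul, hfix] at h
    exact mul_left_cancel₀ hQ.ne_zero h
  obtain ⟨Q₀, rfl⟩ := mem_range_map_of_map_frobenius_eq (F := F) hfix
  obtain ⟨T₀, rfl⟩ := mem_range_map_of_map_frobenius_eq (F := F) hTfix
  rw [← map_mul] at hT
  rcases hP.isUnit_or_isUnit (hinj hT) with h | h
  · exact (hQ.not_isUnit (h.map _)).elim
  · rw [hT, map_mul]
    exact (irreducible_mul_isUnit (h.map _)).2 hQ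

theorem stmt_16 {Fq : Type*} [Field Fq] [Fintype Fq]
    (q n : ℕ) (hq : Fintype.card Fq = q) (hn : n ∣ q - 1)
    (f : Polynomial Fq) (hf : 0 < f.natDegree)
    (x₀ y₀ : Fq) (hy₀ : y₀ ≠ 0) (hsol : y₀ ^ n = f.eval x₀)
    (P : MvPolynomial (Fin 2) Fq) (hP : Irreducible P)
    (hPdvd : P ∣ (MvPolynomial.X 1 ^ n -
      Polynomial.aeval (MvPolynomial.X 0) f : MvPolynomial (Fin 2) Fq)) :
    Irreducible (MvPolynomial.map (algebraMap Fq (AlgebraicClosure Fq)) P) := by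
  subst hq
  set K := AlgebraicClosure Fq
  set ι := algebraMap Fq K
  have hq1 : 1 < Fintype.card Fq := Fintype.one_lt_card
  have hn0 : n ≠ 0 := by
    rintro rfl
    have := zero_dvd_iff.1 hn
    omega
  have hnK : (n : K) ≠ 0 := by
    intro h
    obtain ⟨k, hk⟩ := hn
    have hcard : ((Fintype.card Fq : ℕ) : K) = 0 := by
      rw [← map_natCast ι, Nat.cast_card_eq_zero, map_zero]
    rw [show Fintype.card Fq = n * k + 1 by omega] at hcard
    rw [Nat.cast_add, Nat.cast_mul, h, zero_mul, zero_add, Nat.cast_one] at hcard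
    exact one_ne_zero hcard
  let G : MvPolynomial (Fin 2) K := MvPolynomial.X 1 ^ n -
    Polynomial.aeval (MvPolynomial.X 0) (f.map ι)
  have hmapaeval : MvPolynomial.map ι (Polynomial.aeval (MvPolynomial.X 0) f) =
      Polynomial.aeval (MvPolynomial.X 0 : MvPolynomial (Fin 2) K) (f.map ι) := by
    rw [Polynomial.aeval_def, Polynomial.aeval_def, Polynomial.eval₂_map, Polynomial.hom_eval₂,
      MvPolynomial.map_X]
    congr 1
    ext x
    simp [MvPolynomial.algebraMap_eq]
  have hPG : P.map ι ∣ G := by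
    have h := map_dvd (MvPolynomial.map ι) hPdvd
    rwa [map_sub, map_pow, MvPolynomial.map_X, hmapaeval] at h
  have hnu : ¬ IsUnit (P.map ι) := by
    intro h
    apply hP.not_isUnit
    rw [MvPolynomial.isUnit_iff] at h ⊢
    simpa [MvPolynomial.coeff_map, IsNilpotent.map_iff ι.injective] using h
  obtain ⟨y, hy⟩ := exists_eval_eq_zero_of_dvd_X_pow_sub hn0 (f.map ι) (ι x₀) hnu hPG
  have hevalf : ∀ z : K, MvPolynomial.eval ![ι x₀, z]
      (Polynomial.aeval (MvPolynomial.X 0) (f.map ι)) = ι (y₀ ^ n) := by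
    intro z
    rw [Polynomial.aeval_def, Polynomial.hom_eval₂]
    have : (MvPolynomial.eval ![ι x₀, z]).comp (algebraMap K (MvPolynomial (Fin 2) K)) =
        RingHom.id K := by
      ext; simp [MvPolynomial.algebraMap_eq]
    rw [this, hsol]
    simp [Polynomial.eval₂_id]
  have hyn : y ^ n = ι (y₀ ^ n) := by
    have h0 : MvPolynomial.eval ![ι x₀, y] G = 0 :=
      zero_dvd_iff.1 (hy ▸ map_dvd (MvPolynomial.eval ![ι x₀, y]) hPG)
    rw [map_sub, hevalf, sub_eq_zero] at h0
    simpa using h0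
  have hy0 : y ≠ 0 := by
    rintro rfl
    rw [zero_pow hn0] at hyn
    exact pow_ne_zero n hy₀ (ι.injective (by rw [← hyn, map_zero]))
  have hyq : y ^ Fintype.card Fq = y := by
    obtain ⟨k, hk⟩ := hn
    rw [show Fintype.card Fq = n * k + 1 by omega, pow_succ, pow_mul, hyn, ← map_pow, ← pow_mul,
      ← hk, FiniteField.pow_card_sub_one_eq_one y₀ hy₀, map_one, one_mul]
  refine MvPolynomial.irreducible_map_of_smooth_rational_point hP (v := ![ι x₀, y]) ?_ hy hPG
    (i := 1) ?_
  · intro i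
    fin_cases i
    · change ι x₀ ^ _ = ι x₀
      rw [← map_pow, FiniteField.pow_card]
    · exact hyq
  · have hder : MvPolynomial.pderiv 1 (Polynomial.aeval (MvPolynomial.X 0 :
        MvPolynomial (Fin 2) K) (f.map ι)) = 0 := by
      rw [Derivation.map_aeval, MvPolynomial.pderiv_X_of_ne (by decide), smul_zero]
    rw [map_sub, hder, sub_zero, Derivation.leibniz_pow, MvPolynomial.pderiv_X_self]
    simp [hnK, hy0]
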